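/- Let Φ ∈ ℝ^10. If f(Φ) is positive definite, then Z(Φ) is positive definite. -/

import Mathlib

noncomputable section

open Matrix

/-- The skew-symmetric cross-product matrix `𝒮(x)` with `𝒮(x) y = x × y`. -/
def crossMat (x : Fin 3 → ℝ) : Matrix (Fin 3) (Fin 3) ℝ :=
  !![0, -x 2, x 1; x 2, 0, -x 0; -x 1, x 0, 0]

/-- The first moment of mass `h = (h₁,h₂,h₃)` from `Φ`. -/
def hVec (Φ : Fin 10 → ℝ) : Fin 3 → ℝ := ![Φ 1, Φ 2, Φ 3]

/-- The inertia matrix `I` from `Φ = (m,h₁,h₂,h₃,I₁₁,I₂₂,I₃₃,I₁₂,I₂₃,I₁₃)`. -/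
def Imat (Φ : Fin 10 → ℝ) : Matrix (Fin 3) (Fin 3) ℝ :=
  !![Φ 4, Φ 7, Φ 9; Φ 7, Φ 5, Φ 8; Φ 9, Φ 8, Φ 6]

/-- `Σ = (1/2)·tr(I)·I₃ − I`. -/
def SigmaMat (Φ : Fin 10 → ℝ) : Matrix (Fin 3) (Fin 3) ℝ :=
  ((1 / 2 : ℝ) * (Imat Φ).trace) • (1 : Matrix (Fin 3) (Fin 3) ℝ) - Imat Φ

/-- The 4×4 matrix `f(Φ) = [[Σ, h],[hᵀ, m]]`. -/
def fMat (Φ : Fin 10 → ℝ) : Matrix (Fin 3 ⊕ Fin 1) (Fin 3 ⊕ Fin 1) ℝ :=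
  Matrix.fromBlocks (SigmaMat Φ) (Matrix.of fun i _ => hVec Φ i)
    (Matrix.of fun _ j => hVec Φ j) (Matrix.of fun _ _ => Φ 0)

/-- The 6×6 matrix `Z(Φ) = [[m·I₃, −𝒮(h)],[−𝒮(h)ᵀ, I]]`. -/
def ZMat (Φ : Fin 10 → ℝ) : Matrix (Fin 3 ⊕ Fin 3) (Fin 3 ⊕ Fin 3) ℝ :=
  Matrix.fromBlocks (Φ 0 • (1 : Matrix (Fin 3) (Fin 3) ℝ)) (-(crossMat (hVec Φ)))
    (-(crossMat (hVec Φ))ᵀ) (Imat Φ)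

/-- The coefficients of the `k`-th coordinate of `v + w × p`, as an affine function of `p`. -/
def velocityCoeff (v w : Fin 3 → ℝ) (k : Fin 3) : Fin 3 ⊕ Fin 1 → ℝ :=
  Sum.elim (crossMat w k) fun _ => v k

theorem velocityCoeff_eq_zero {v w : Fin 3 → ℝ} (h : ∀ k, velocityCoeff v w k = 0) :
    Sum.elim v w = 0 := by
  have h₀ (k : Fin 3) (i : Fin 3) : crossMat w k i = 0 := congrFun (h k) (Sum.inl i)
  have h₁ (k : Fin 3) : v k = 0 := congrFun (h k) (Sum.inr 0)
  have w₀ : w 0 = 0 := by simpa [crossMat] using h₀ 2 1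
  have w₁ : w 1 = 0 := by simpa [crossMat] using h₀ 0 2
  have w₂ : w 2 = 0 := by simpa [crossMat] using h₀ 1 0
  ext i
  rcases i with i | i
  · exact h₁ i
  · fin_cases i <;> assumption

/-- The quadratic form of `ZMat Φ` is a sum of three values of the quadratic form of `fMat Φ`. -/
theorem dotProduct_ZMat_mulVec (Φ : Fin 10 → ℝ) (v w : Fin 3 → ℝ) :
    Sum.elim v w ⬝ᵥ (ZMat Φ *ᵥ Sum.elim v w) =
      ∑ k, velocityCoeff v w k ⬝ᵥ (fMat Φ *ᵥ velocityCoeff v w k) := by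
  simp [ZMat, fMat, velocityCoeff, SigmaMat, Imat, hVec, crossMat, dotProduct, mulVec,
    Fin.sum_univ_three, Matrix.trace, Matrix.one_apply]
  ring

theorem ZMat_isHermitian (Φ : Fin 10 → ℝ) : (ZMat Φ).IsHermitian := by
  refine Matrix.IsHermitian.fromBlocks ?_ ?_ ?_
  · simp [Matrix.IsHermitian]
  · simp [Matrix.conjTranspose_eq_transpose_of_trivial]
  · ext i j
    fin_cases i <;> fin_cases j <;> rfl

/-- If `f(Φ)` is positive definite then `Z(Φ)` is positive definite. -/
theorem ZMat_posDef_of_fMat_posDef (Φ : Fin 10 → ℝ) (hf : (fMat Φ).PosDef) :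
    (ZMat Φ).PosDef := by
  refine Matrix.PosDef.of_dotProduct_mulVec_pos (ZMat_isHermitian Φ) fun x hx => ?_
  obtain ⟨v, w, rfl⟩ : ∃ v w, x = Sum.elim v w := ⟨_, _, (Sum.elim_comp_inl_inr x).symm⟩
  obtain ⟨k, hk⟩ : ∃ k, velocityCoeff v w k ≠ 0 := by
    contrapose! hx
    exact velocityCoeff_eq_zero hx
  rw [star_trivial, dotProduct_ZMat_mulVec]
  exact Finset.sum_pos' (fun i _ => hf.posSemidef.dotProduct_mulVec_nonneg _)
    ⟨k, Finset.mem_univ k, hf.dotProduct_mulVec_pos hk⟩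

end
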